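/- arXiv:2402.03718 — 3 statements merged into one kernel-verified Lean document; each statement's English description precedes it below -/
import Mathlib

section
/- Let (G, Ω) be a holomorphic IFS with attractor A satisfying the strong separation condition. Then there exists δ > 0 such that every finite composition g_w, w ∈ Λ*, is a local holomorphic symmetry of A on every Euclidean ball B(a, δ) with a ∈ A. -/
open Set Metric

noncomputable section

/-- A finite holomorphic IFS: a bounded domain `Ω ⊂ ℂ` together with finitely many
univalent maps `g i : Ω → Ω` with `closure (g i '' Ω) ⊆ Ω`. -/
structure HolIFS where
  /-- the number of maps -/
  m : ℕ
  hm : 1 ≤ m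
  /-- the domain -/
  Ω : Set ℂ
  hopen : IsOpen Ω
  hconn : IsConnected Ω
  hbdd : Bornology.IsBounded Ω
  /-- the maps of the IFS -/
  g : Fin m → ℂ → ℂ
  hdiff : ∀ i, DifferentiableOn ℂ (g i) Ω
  hinj : ∀ i, Set.InjOn (g i) Ω
  hcl : ∀ i, closure (g i '' Ω) ⊆ Ω

/-- `A` is the attractor of the IFS `S`: the (unique) nonempty compact subset of `Ω`
with `A = ⋃ i, g i '' A`. -/
def HolIFS.IsAttractor (S : HolIFS) (A : Set ℂ) : Prop :=
  A.Nonempty ∧ IsCompact A ∧ A ⊆ S.Ω ∧ A = ⋃ i, S.g i '' A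

/-- The strong separation condition for the IFS `S` with attractor `A`. -/
def HolIFS.SSC (S : HolIFS) (A : Set ℂ) : Prop :=
  ∀ i j : Fin S.m, i ≠ j → Disjoint (S.g i '' A) (S.g j '' A)

/-- For a finite word `w = [i₁, …, i_k]`, the composition `g_w = g i₁ ∘ ⋯ ∘ g i_k`. -/
def HolIFS.word (S : HolIFS) (w : List (Fin S.m)) : ℂ → ℂ :=
  w.foldr (fun i f => S.g i ∘ f) id

/-- `H` is a local holomorphic symmetry of the compact set `K` on the domain `D`. -/
def IsSymmetryOn (K D : Set ℂ) (H : ℂ → ℂ) : Prop :=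
  DifferentiableOn ℂ H D ∧ ∀ x ∈ D, (x ∈ K ↔ H x ∈ K)

theorem HolIFS.word_props (S : HolIFS) (A : Set ℂ) (hA : S.IsAttractor A)
    (w : List (Fin S.m)) :
    DifferentiableOn ℂ (S.word w) S.Ω ∧ MapsTo (S.word w) S.Ω S.Ω ∧ MapsTo (S.word w) A A := by
  induction w with
  | nil => exact ⟨differentiableOn_id, fun x hx => hx, fun x hx => hx⟩
  | cons i w ih =>
    obtain ⟨h1, h2, h3⟩ := ih
    refine ⟨(S.hdiff i).comp h1 h2, fun x hx => ?_, fun x hx => ?_⟩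
    · exact S.hcl i (subset_closure ⟨_, h2 hx, rfl⟩)
    · rw [hA.2.2.2]
      exact mem_iUnion.2 ⟨i, _, h3 hx, rfl⟩

/-- For a holomorphic IFS with the SSC there exists `δ > 0` such that every finite
composition `g_w`, `w ∈ Λ*`, is a local holomorphic symmetry of the attractor `A` on every
Euclidean ball `B(a, δ)`, `a ∈ A`. -/
theorem stmt_5 (S : HolIFS) (A : Set ℂ) (hA : S.IsAttractor A) (hA2 : A.Nontrivial)
    (hSSC : S.SSC A) :
    ∃ δ > (0 : ℝ), ∀ w : List (Fin S.m), w ≠ [] → ∀ a ∈ A,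
      IsSymmetryOn A (Metric.ball a δ) (S.word w) := by
  have hP := S.word_props A hA
  obtain ⟨hne, hc, hsub, heq⟩ := hA
  have hgA : ∀ i, IsCompact (S.g i '' A) := fun i =>
    hc.image_of_continuousOn ((S.hdiff i).continuousOn.mono hsub)
  let U : Fin S.m → Set ℂ := fun i => (⋃ j : {j // j ≠ i}, S.g j '' A)ᶜ
  have hU : ∀ i, IsOpen (U i) := fun i =>
    (isClosed_iUnion_of_finite fun j : {j // j ≠ i} => (hgA j).isClosed).isOpen_compl
  have hcov : A ⊆ ⋃ i, U i := by
    intro x hx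
    rw [heq] at hx
    obtain ⟨i, hi⟩ := mem_iUnion.1 hx
    refine mem_iUnion.2 ⟨i, fun h => ?_⟩
    obtain ⟨⟨j, hj⟩, h⟩ := mem_iUnion.1 h
    exact (disjoint_left.1 (hSSC j i hj)) h hi
  obtain ⟨ε, hε, hleb⟩ := lebesgue_number_lemma_of_metric hc hU hcov
  have hkey : ∀ i, ∀ y ∈ S.g i '' A, ∀ z ∈ A, dist z y < ε → z ∈ S.g i '' A := by
    intro i y hy z hz hd
    have hyA : y ∈ A := by rw [heq]; exact mem_iUnion.2 ⟨i, hy⟩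
    obtain ⟨k, hk⟩ := hleb y hyA
    have hki : i = k := by
      by_contra hne
      exact hk (mem_ball_self hε) (mem_iUnion.2 ⟨⟨i, hne⟩, hy⟩)
    subst hki
    have hz' := hz
    rw [heq] at hz'
    obtain ⟨j, hj⟩ := mem_iUnion.1 hz'
    by_cases hji : j = i
    · exact hji ▸ hj
    · exact absurd (mem_iUnion.2 ⟨⟨j, hji⟩, hj⟩) (hk (mem_ball.2 hd))
  obtain ⟨r, hr, hrΩ⟩ := hc.exists_thickening_subset_open S.hopen hsub
  have hball : ∀ a ∈ A, ball a r ⊆ S.Ω := fun a ha =>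
    (ball_subset_thickening ha r).trans hrΩ
  set M : ℝ := diam S.Ω + 1 with hM
  have hMpos : 0 < M := by have := diam_nonneg (s := S.Ω); linarith
  have hlip : ∀ w, ∀ a ∈ A, ∀ x ∈ ball a r,
      dist (S.word w x) (S.word w a) ≤ M / r * dist x a := by
    intro w a ha x hx
    refine Complex.dist_le_div_mul_dist_of_mapsTo_ball ((hP w).1.mono (hball a ha)) ?_ hx
    intro z hz
    have := dist_le_diam_of_mem S.hbdd ((hP w).2.1 (hball a ha hz)) ((hP w).2.1 (hsub ha))
    first
      | exact mem_ball.2 (by linarith)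
      | exact mem_closedBall.2 (by linarith)
  refine ⟨min r (ε * r / M), lt_min hr (by positivity), fun w hw a ha => ?_⟩
  have hbr : ball a (min r (ε * r / M)) ⊆ ball a r := ball_subset_ball (min_le_left _ _)
  refine ⟨(hP w).1.mono (hbr.trans (hball a ha)), fun x hx => ⟨fun h => (hP w).2.2 h, ?_⟩⟩
  have hxr := hbr hx
  have hlt : ∀ v, dist (S.word v x) (S.word v a) < ε := by
    intro v
    refine (hlip v a ha x hxr).trans_lt ?_
    have h1 : dist x a < ε * r / M := (mem_ball.1 hx).trans_le (min_le_right _ _)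
    calc M / r * dist x a < M / r * (ε * r / M) := by gcongr
      _ = ε := by field_simp
  clear hne hw
  induction w with
  | nil => exact fun h => h
  | cons i v ih =>
    intro h
    obtain ⟨b, hb, hbe⟩ := hkey i (S.word (i :: v) a) ⟨_, (hP v).2.2 ha, rfl⟩ _ h (hlt _)
    have : b = S.word v x :=
      S.hinj i (hsub hb) ((hP v).2.1 (hball a ha hxr)) hbe
    exact ih (this ▸ hb)
end
end

section
/- Let A be the attractor of a holomorphic IFS (G, Ω) with G = (g_1, …, g_m). Assume there exists an open set U ⊂ Ω such that A ⊂ closure(U), A ∩ U ≠ ∅, and the sets g_i(U) for i = 1, …, m are pairwise disjoint. Then every g_i is a symmetry of A on each connected component D of U that intersects A. -/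
open Set Metric

noncomputable section

/-- Lemma: let `A` be the attractor of a holomorphic IFS `(G, Ω)` and `U ⊆ Ω` an open set
with `A ⊆ closure U`, `A ∩ U ≠ ∅`, and the sets `g i '' U` pairwise disjoint. Then every
`g i` is a symmetry of `A` on each connected component of `U` that intersects `A`. -/
theorem stmt_7 (S : HolIFS) (A : Set ℂ) (hA : S.IsAttractor A) (hA2 : A.Nontrivial)
    (U : Set ℂ) (hUopen : IsOpen U) (hUsub : U ⊆ S.Ω)
    (hAclU : A ⊆ closure U) (hAU : (A ∩ U).Nonempty)
    (hdisj : ∀ i j : Fin S.m, i ≠ j → Disjoint (S.g i '' U) (S.g j '' U)) :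
    ∀ i : Fin S.m, ∀ x ∈ U, (connectedComponentIn U x ∩ A).Nonempty →
      IsSymmetryOn A (connectedComponentIn U x) (S.g i) := by
  obtain ⟨_, _, hAΩ, hAeq⟩ := hA
  intro i x hx _
  have hsub := connectedComponentIn_subset U x
  refine ⟨(S.hdiff i).mono (hsub.trans hUsub), fun y hy => ⟨fun h => ?_, fun h => ?_⟩⟩
  · rw [hAeq]
    exact mem_iUnion.2 ⟨i, y, h, rfl⟩
  · have hyU := hsub hy
    rw [hAeq] at h
    obtain ⟨j, a, ha, hja⟩ := mem_iUnion.1 h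
    by_cases hij : i = j
    · subst hij
      have := S.hinj i (hAΩ ha) (hUsub hyU) hja
      exact this ▸ ha
    · exfalso
      have hop : IsOpen (S.g i '' U) := by
        rcases ((S.hdiff i).analyticOnNhd S.hopen).is_constant_or_isOpen
          S.hconn.isPreconnected with ⟨w, hw⟩ | h
        · exfalso
          obtain ⟨p, hp, q, hq, hpq⟩ := hA2
          exact hpq (S.hinj i (hAΩ hp) (hAΩ hq) ((hw p (hAΩ hp)).trans (hw q (hAΩ hq)).symm))
        · exact h U hUsub hUopen
      have hc : ContinuousAt (S.g j) a :=
        (S.hdiff j).continuousOn.continuousAt (S.hopen.mem_nhds (hAΩ ha))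
      have hn : S.g j ⁻¹' (S.g i '' U) ∈ nhds a :=
        hc (hop.mem_nhds (hja ▸ mem_image_of_mem _ hyU))
      obtain ⟨u, hu1, hu2⟩ := mem_closure_iff_nhds.1 (hAclU ha) _ hn
      exact (disjoint_left.1 (hdisj i j hij)) hu1 (mem_image_of_mem _ hu2)
end
end

section
/- Let I ⊂ ℝ be a bounded open interval and V a simply connected domain symmetric with respect to ℝ such that closure(I) ⊂ V. Then there exist two angles 0 < θ* < θ*' < π/2 as follows: for every θ ∈ (0, θ*) there exists θ' ∈ (0, θ*') such that for every univalent map g : V → ℂ which is real (i.e., g(conj(z)) = conj(g(z)) for all z ∈ V), one has g(Ω_θ(I)) ⊂ Ω_{θ'}(g(I)), where both sides are well-defined. -/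
open Set Metric
noncomputable section

/-- The disk `D_θ(I)` for `I = (a, b)`: the Euclidean disk with `D_θ(I) ∩ ℝ = (a, b)` whose
boundary circle meets `ℝ` at `a` and `b` under the angles `θ` and `π − θ` respectively.
Its center is `(a+b)/2 − i·((b−a)/2)/tan θ` and its radius is `(b−a)/(2 sin θ)`. -/
def Dtheta (a b θ : ℝ) : Set ℂ :=
  Metric.ball ((((a + b) / 2 : ℝ) : ℂ) - Complex.I * ((((b - a) / 2) / Real.tan θ : ℝ) : ℂ))
    ((b - a) / (2 * Real.sin θ))

/-- The part of `D_θ(I)` in the open upper half plane. -/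
def DthetaUpper (a b θ : ℝ) : Set ℂ :=
  {z ∈ Dtheta a b θ | 0 < z.im}

/-- The domain `Ω_θ(I)`, `I = (a, b)`: the union of the upper part of `D_θ(I)`, its
reflection in `ℝ`, and the interval `I` itself. -/
def OmegaTheta (a b θ : ℝ) : Set ℂ :=
  DthetaUpper a b θ ∪ (fun z => (starRingEnd ℂ) z) '' DthetaUpper a b θ ∪
    {z : ℂ | z.im = 0 ∧ a < z.re ∧ z.re < b}


lemma slit_of_punctured (f : ℂ → ℂ) (t : ℂ) (hf : AnalyticAt ℂ f t)
    (h : ∀ᶠ z in nhdsWithin t {t}ᶜ, f z ∈ Complex.slitPlane) : f t ∈ Complex.slitPlane := by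
  by_contra hn
  have h' : ∀ᶠ z in nhds t, f z ∈ Complex.slitPlane ∨ z = t := by
    rw [eventually_nhdsWithin_iff] at h
    filter_upwards [h] with z hz
    by_cases hzt : z = t
    · exact Or.inr hzt
    · exact Or.inl (hz hzt)
  rcases hf.eventually_constant_or_nhds_le_map_nhds with hc | ho
  · have hc' : ∀ᶠ z in nhdsWithin t {t}ᶜ, f z = f t := hc.filter_mono nhdsWithin_le_nhds
    obtain ⟨z, hz1, hz2⟩ := (h.and hc').exists
    rw [hz2] at hz1
    exact hn hz1
  · have h2 : ∀ᶠ w in nhds (f t), w ∈ Complex.slitPlane ∨ w = f t := by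
      apply ho
      rw [Filter.mem_map]
      filter_upwards [h'] with z hz
      rcases hz with hz | hz
      · exact Or.inl hz
      · exact Or.inr (by rw [hz])
    rw [Metric.eventually_nhds_iff] at h2
    obtain ⟨ε, hε, h3⟩ := h2
    have h4 := @h3 (f t - ((ε / 2 : ℝ) : ℂ)) (by
      simp [abs_of_pos hε]; linarith)
    rw [Complex.mem_slitPlane_iff] at hn h4
    push Not at hn
    rcases h4 with (h4 | h4) | h4
    · have := hn.1
      rw [Complex.sub_re, Complex.ofReal_re] at h4
      linarith
    · rw [Complex.sub_im, Complex.ofReal_im] at h4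
      exact h4 (by linarith [hn.2])
    · have := congrArg Complex.re h4
      rw [Complex.sub_re, Complex.ofReal_re] at this
      linarith

lemma div_slit {u v : ℂ} (h : 0 < u.im * v.im) : u / v ∈ Complex.slitPlane := by
  rw [Complex.mem_slitPlane_iff]
  by_contra hn
  push Not at hn
  have hv : v ≠ 0 := by
    rintro rfl
    simp at h
  have e : u = (u / v) * v := by field_simp
  have e2 := congrArg Complex.im e
  rw [Complex.mul_im, hn.2] at e2
  rw [e2] at h
  nlinarith [hn.1, mul_self_nonneg v.im]

lemma schwarz_slit (h : ℂ → ℂ) (x : ℂ) (r p : ℝ) (hr : 0 < r) (hp : 0 < p)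
    (hd : DifferentiableOn ℂ h (ball x r)) (hs : ∀ z ∈ ball x r, h z ∈ Complex.slitPlane)
    (hx : h x = p) (z : ℂ) (hz : ‖z - x‖ ≤ r / 100) : ‖h z - p‖ ≤ p / 10 := by
  set s : ℂ → ℂ := fun z => Complex.exp (Complex.log (h z) / 2) with hsdef
  have hsd : DifferentiableOn ℂ s (ball x r) :=
    ((hd.clog hs).div_const 2).cexp
  have hsq : ∀ z ∈ ball x r, s z ^ 2 = h z := by
    intro z hz
    rw [hsdef]
    simp only
    rw [← Complex.exp_nat_mul]
    push_cast
    rw [mul_div_cancel₀ _ (two_ne_zero), Complex.exp_log (Complex.slitPlane_ne_zero (hs z hz))]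
  have hre : ∀ z ∈ ball x r, 0 < (s z).re := by
    intro z hz
    rw [hsdef]
    simp only
    rw [Complex.exp_re]
    apply mul_pos (Real.exp_pos _)
    have e : (Complex.log (h z) / 2).im = Complex.arg (h z) / 2 := by
      rw [show (2:ℂ) = ((2:ℝ):ℂ) by simp, Complex.div_ofReal_im, Complex.log_im]
    rw [e]
    have h1 := Complex.neg_pi_lt_arg (h z)
    have h2 := Complex.arg_le_pi (h z)
    have h3 := (Complex.mem_slitPlane_iff_arg.1 (hs z hz)).1
    have h4 := lt_of_le_of_ne h2 h3
    exact Real.cos_pos_of_mem_Ioo ⟨by linarith, by linarith⟩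
  set q : ℝ := Real.exp (Real.log p / 2) with hq
  have hq0 : 0 < q := Real.exp_pos _
  have hsx : s x = q := by
    rw [hsdef, hq]
    simp only
    rw [hx, Complex.ofReal_exp, ← Complex.ofReal_log hp.le]
    push_cast
    rfl
  have hne : ∀ z ∈ ball x r, s z + q ≠ 0 := by
    intro z hz h0
    have := congrArg Complex.re h0
    rw [Complex.add_re, Complex.ofReal_re, Complex.zero_re] at this
    linarith [hre z hz]
  have hxb : x ∈ ball x r := mem_ball_self hr
  have hzb : z ∈ ball x r := by
    rw [mem_ball, dist_eq_norm]
    linarith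
  set m : ℂ → ℂ := fun z => (s z - q) / (s z + q) with hm
  have hmd : DifferentiableOn ℂ m (ball x r) :=
    (hsd.sub_const _).div (hsd.add_const _) hne
  have hmx : m x = 0 := by rw [hm]; simp [hsx]
  have hmaps : MapsTo m (ball x r) (closedBall (m x) 1) := by
    intro z hz
    rw [hmx, mem_closedBall_zero_iff, hm]
    simp only
    rw [norm_div, div_le_one (norm_pos_iff.2 (hne z hz))]
    rw [← sq_le_sq₀ (norm_nonneg _) (norm_nonneg _), ← Complex.normSq_eq_norm_sq,
      ← Complex.normSq_eq_norm_sq, Complex.normSq_apply, Complex.normSq_apply]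
    simp only [Complex.sub_re, Complex.sub_im, Complex.add_re, Complex.add_im,
      Complex.ofReal_re, Complex.ofReal_im]
    nlinarith [mul_pos (hre z hz) hq0]
  have hsch := Complex.dist_le_div_mul_dist_of_mapsTo_ball hmd hmaps hzb
  rw [hmx, dist_zero_right, dist_eq_norm] at hsch
  have hm1 : ‖m z‖ ≤ 1 / 100 := by
    refine hsch.trans ?_
    rw [div_mul_eq_mul_div, one_mul, div_le_iff₀ hr]
    linarith
  have e1 : s z * (1 - m z) = q * (1 + m z) := by
    have := hne z hzb
    rw [hm]
    field_simp
    ring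
  have e2 : (q : ℂ) ^ 2 = p := by rw [← hsx, hsq x hxb, hx]
  have e3 : (h z - p) * (1 - m z) ^ 2 = 4 * p * m z := by
    rw [← hsq z hzb, ← e2]
    linear_combination (s z * (1 - m z) + q * (1 + m z)) * e1
  have e4 := congrArg norm e3
  rw [norm_mul, norm_mul, norm_mul, norm_pow, Complex.norm_real, Real.norm_of_nonneg hp.le] at e4
  have h1m : 99 / 100 ≤ ‖1 - m z‖ := by
    have := norm_sub_norm_le (1:ℂ) (m z)
    rw [norm_one] at this
    linarith
  have h4 : ‖(4:ℂ)‖ = 4 := by simp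
  rw [h4] at e4
  have h5 : (99 / 100 : ℝ) ^ 2 ≤ ‖1 - m z‖ ^ 2 := by gcongr
  have h6 : 4 * p * ‖m z‖ ≤ 4 * p * (1 / 100) := by gcongr
  have h7 := mul_le_mul_of_nonneg_left h5 (norm_nonneg (h z - p))
  nlinarith

lemma re_deriv_nonneg (g : ℂ → ℂ) (g' : ℂ) (x : ℝ) (r : ℝ) (hr : 0 < r) (hg : HasDerivAt g g' x)
    (h0 : (g x).im = 0) (hpos : ∀ y : ℝ, 0 < y → y < r → 0 < (g (x + y * Complex.I)).im) :
    0 ≤ g'.re := by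
  have h1 : HasDerivAt (fun y : ℝ => g (x + y * Complex.I)) (g' * Complex.I) (0:ℝ) := by
    have hl : HasDerivAt (fun y : ℂ => (x:ℂ) + y * Complex.I) Complex.I ((0:ℝ):ℂ) := by
      simpa using ((hasDerivAt_id ((0:ℝ):ℂ)).mul_const Complex.I).const_add (x:ℂ)
    have hg2 : HasDerivAt g g' ((x:ℂ) + ((0:ℝ):ℂ) * Complex.I) := by simpa using hg
    exact (HasDerivAt.comp ((0:ℝ):ℂ) hg2 hl).comp_ofReal
  have h2 : HasDerivAt (fun y : ℝ => (g (x + y * Complex.I)).im) g'.re (0:ℝ) := by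
    have h9 : HasDerivAt (fun y : ℝ => (g (x + y * Complex.I)).im) (Complex.imCLM (g' * Complex.I)) (0:ℝ) :=
      (Complex.imCLM.hasFDerivAt.comp_hasDerivAt (0:ℝ) h1)
    simpa using h9
  have h3 := h2.tendsto_slope_zero_right
  refine ge_of_tendsto h3 ?_
  filter_upwards [Ioo_mem_nhdsGT hr] with y hy
  have := hpos y hy.1 hy.2
  simp [h0]
  have := hy.1
  positivity

def Rect (a b r : ℝ) : Set ℂ := {z | a - r < z.re ∧ z.re < b + r ∧ -r < z.im ∧ z.im < r}

lemma Rect_open (a b r : ℝ) : IsOpen (Rect a b r) := by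
  refine IsOpen.inter ?_ (IsOpen.inter ?_ (IsOpen.inter ?_ ?_))
  · exact isOpen_lt continuous_const Complex.continuous_re
  · exact isOpen_lt Complex.continuous_re continuous_const
  · exact isOpen_lt continuous_const Complex.continuous_im
  · exact isOpen_lt Complex.continuous_im continuous_const

section core
variable {a b r : ℝ} {g : ℂ → ℂ}

lemma mem_Rect_real (hr : 0 < r) {x : ℝ} : (x : ℂ) ∈ Rect a b r ↔ x ∈ Ioo (a - r) (b + r) := by
  simp [Rect, hr]

lemma g_real (hr : 0 < r) (hreal : ∀ z ∈ Rect a b r, g ((starRingEnd ℂ) z) = (starRingEnd ℂ) (g z))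
    {x : ℝ} (hx : x ∈ Ioo (a - r) (b + r)) : g x = ((g x).re : ℂ) := by
  have := hreal x ((mem_Rect_real hr).2 hx)
  rw [Complex.conj_ofReal] at this
  exact (Complex.conj_eq_iff_re.1 this.symm).symm

lemma g_mono (hr : 0 < r) (hd : DifferentiableOn ℂ g (Rect a b r))
    (hinj : InjOn g (Rect a b r))
    (hreal : ∀ z ∈ Rect a b r, g ((starRingEnd ℂ) z) = (starRingEnd ℂ) (g z))
    (hpos : ∀ z ∈ Rect a b r, 0 < z.im → 0 < (g z).im) :
    StrictMonoOn (fun x : ℝ => (g x).re) (Ioo (a - r) (b + r)) := by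
  have hda : ∀ x ∈ Ioo (a - r) (b + r), HasDerivAt g (deriv g x) (x:ℂ) := fun x hx =>
    (hd.differentiableAt ((Rect_open a b r).mem_nhds ((mem_Rect_real hr).2 hx))).hasDerivAt
  have hdr : ∀ x ∈ Ioo (a - r) (b + r), HasDerivAt (fun x : ℝ => (g x).re) (deriv g x).re x :=
    fun x hx => (hda x hx).real_of_complex
  apply MonotoneOn.strictMonoOn_of_injOn
  · apply monotoneOn_of_deriv_nonneg (convex_Ioo _ _)
    · exact fun x hx => (hdr x hx).continuousAt.continuousWithinAt
    · rw [interior_Ioo]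
      exact fun x hx => (hdr x hx).differentiableAt.differentiableWithinAt
    · rw [interior_Ioo]
      intro x hx
      rw [(hdr x hx).deriv]
      apply re_deriv_nonneg g _ x r hr (hda x hx)
      · rw [g_real hr hreal hx]; simp
      · intro y hy hyr
        apply hpos
        · simp [Rect, hx.1, hx.2, hyr]
          linarith
        · simpa using hy
  · intro x hx y hy hxy
    simp only at hxy
    have : g x = g y := by rw [g_real hr hreal hx, g_real hr hreal hy, hxy]
    exact_mod_cast hinj ((mem_Rect_real hr).2 hx) ((mem_Rect_real hr).2 hy) this

lemma phi_slit (hr : 0 < r) (hd : DifferentiableOn ℂ g (Rect a b r))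
    (hinj : InjOn g (Rect a b r))
    (hreal : ∀ z ∈ Rect a b r, g ((starRingEnd ℂ) z) = (starRingEnd ℂ) (g z))
    (hpos : ∀ z ∈ Rect a b r, 0 < z.im → 0 < (g z).im)
    (hneg : ∀ z ∈ Rect a b r, z.im < 0 → (g z).im < 0)
    {t : ℝ} (ht : t ∈ Ioo (a - r) (b + r)) {z : ℂ} (hz : z ∈ Rect a b r) :
    dslope g t z ∈ Complex.slitPlane := by
  have key : ∀ z ∈ Rect a b r, z ≠ t → dslope g t z ∈ Complex.slitPlane := by
    intro z hz hzt
    rw [dslope_of_ne _ hzt, slope_def_field]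
    have hgt : (g t).im = 0 := by rw [g_real hr hreal ht]; simp
    rcases lt_trichotomy z.im 0 with h | h | h
    · apply div_slit
      have := hneg z hz h
      simp only [Complex.sub_im, hgt, Complex.ofReal_im, sub_zero]
      nlinarith
    · obtain ⟨x, rfl⟩ : ∃ x : ℝ, z = x := ⟨z.re, by apply Complex.ext <;> simp [h]⟩
      have hx := (mem_Rect_real hr).1 hz
      have hm := g_mono hr hd hinj hreal hpos
      have hxt : x ≠ t := fun e => hzt (by rw [e])
      rw [g_real hr hreal hx, g_real hr hreal ht]
      have : 0 < ((g x).re - (g t).re) / (x - t) := by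
        rcases lt_or_gt_of_ne hxt with h | h
        · have := hm hx ht h
          simp only at this
          exact div_pos_of_neg_of_neg (by linarith) (by linarith)
        · have := hm ht hx h
          simp only at this
          exact div_pos (by linarith) (by linarith)
      rw [← Complex.ofReal_sub, ← Complex.ofReal_sub, ← Complex.ofReal_div]
      exact Complex.ofReal_mem_slitPlane.2 this
    · apply div_slit
      have := hpos z hz h
      simp only [Complex.sub_im, hgt, Complex.ofReal_im, sub_zero]
      positivity
  by_cases hzt : z = t
  · rw [hzt]
    have hn : Rect a b r ∈ nhds (t:ℂ) := (Rect_open a b r).mem_nhds ((mem_Rect_real hr).2 ht)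
    apply slit_of_punctured
    · exact ((Complex.differentiableOn_dslope hn).2 hd).analyticAt hn
    · filter_upwards [mem_nhdsWithin_of_mem_nhds hn, self_mem_nhdsWithin] with w hw hw2
      exact key w hw hw2
  · exact key z hz hzt

lemma h_slit (hr : 0 < r) (hab : a < b) (hd : DifferentiableOn ℂ g (Rect a b r))
    (hinj : InjOn g (Rect a b r))
    (hreal : ∀ z ∈ Rect a b r, g ((starRingEnd ℂ) z) = (starRingEnd ℂ) (g z))
    (hpos : ∀ z ∈ Rect a b r, 0 < z.im → 0 < (g z).im)
    (hneg : ∀ z ∈ Rect a b r, z.im < 0 → (g z).im < 0)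
    {z : ℂ} (hz : z ∈ Rect a b r) :
    dslope g a z / dslope g b z ∈ Complex.slitPlane := by
  have ha : a ∈ Ioo (a - r) (b + r) := ⟨by linarith, by linarith⟩
  have hb : b ∈ Ioo (a - r) (b + r) := ⟨by linarith, by linarith⟩
  have hm := g_mono hr hd hinj hreal hpos
  have hAB : (g a).re < (g b).re := hm ha hb hab
  have hga := g_real hr hreal ha
  have hgb := g_real hr hreal hb
  set A := (g a).re
  set B := (g b).re
  have hdh : DifferentiableOn ℂ (fun z => dslope g a z / dslope g b z) (Rect a b r) := by
    apply DifferentiableOn.div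
    · exact (Complex.differentiableOn_dslope ((Rect_open a b r).mem_nhds ((mem_Rect_real hr).2 ha))).2 hd
    · exact (Complex.differentiableOn_dslope ((Rect_open a b r).mem_nhds ((mem_Rect_real hr).2 hb))).2 hd
    · exact fun z hz => Complex.slitPlane_ne_zero (phi_slit hr hd hinj hreal hpos hneg hb hz)
  have key : ∀ z ∈ Rect a b r, z ≠ a → z ≠ b → dslope g a z / dslope g b z ∈ Complex.slitPlane := by
    intro z hz hza hzb
    have pa := phi_slit hr hd hinj hreal hpos hneg ha hz
    have pb := phi_slit hr hd hinj hreal hpos hneg hb hz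
    rw [dslope_of_ne _ hza, slope_def_field] at *
    rw [dslope_of_ne _ hzb, slope_def_field] at *
    rw [hga] at *
    rw [hgb] at *
    have hgzb : g z - B ≠ 0 := by
      intro h0
      rw [h0, zero_div] at pb
      exact Complex.slitPlane_ne_zero pb rfl
    have hgza : g z - A ≠ 0 := by
      intro h0
      rw [h0, zero_div] at pa
      exact Complex.slitPlane_ne_zero pa rfl
    have hzb' : z - b ≠ 0 := sub_ne_zero.2 hzb
    have hza' : z - a ≠ 0 := sub_ne_zero.2 hza
    have him : ∀ (w : ℂ) (P Q : ℝ), ((w - P) / (Q - w)).im = w.im * (Q - P) / Complex.normSq (Q - w) := by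
      intro w P Q
      rw [Complex.div_im]
      simp only [Complex.sub_re, Complex.sub_im, Complex.ofReal_re, Complex.ofReal_im]
      ring
    have hN1 : 0 < Complex.normSq (B - g z) := Complex.normSq_pos.2 (by
      rw [← neg_sub]; exact neg_ne_zero.2 hgzb)
    have hN2 : 0 < Complex.normSq (b - z) := Complex.normSq_pos.2 (by
      rw [← neg_sub]; exact neg_ne_zero.2 hzb')
    have e : (g z - A) / (z - a) / ((g z - B) / (z - b)) =
        ((g z - A) / (B - g z)) / ((z - a) / (b - z)) := by
      rw [← neg_sub (g z) (B:ℂ), ← neg_sub z (b:ℂ)]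
      field_simp
    rcases lt_trichotomy z.im 0 with h | h | h
    · have := hneg z hz h
      rw [e]
      apply div_slit
      rw [him, him]
      apply mul_pos_of_neg_of_neg
      · exact div_neg_of_neg_of_pos (mul_neg_of_neg_of_pos this (by linarith)) hN1
      · exact div_neg_of_neg_of_pos (mul_neg_of_neg_of_pos h (by linarith)) hN2
    · obtain ⟨x, rfl⟩ : ∃ x : ℝ, z = x := ⟨z.re, by apply Complex.ext <;> simp [h]⟩
      have hx := (mem_Rect_real hr).1 hz
      rw [g_real hr hreal hx, ← Complex.ofReal_sub, ← Complex.ofReal_sub, ← Complex.ofReal_div] at pa pb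
      rw [g_real hr hreal hx, ← Complex.ofReal_sub, ← Complex.ofReal_sub, ← Complex.ofReal_div,
        ← Complex.ofReal_sub, ← Complex.ofReal_sub, ← Complex.ofReal_div, ← Complex.ofReal_div]
      rw [Complex.ofReal_mem_slitPlane] at *
      exact div_pos pa pb
    · have := hpos z hz h
      rw [e]
      apply div_slit
      rw [him, him]
      apply mul_pos
      · exact div_pos (mul_pos this (by linarith)) hN1
      · exact div_pos (mul_pos h (by linarith)) hN2
  by_cases hzt : z ≠ a ∧ z ≠ b
  · exact key z hz hzt.1 hzt.2
  · have hn : Rect a b r ∈ nhds z := (Rect_open a b r).mem_nhds hz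
    apply slit_of_punctured (fun z => dslope g a z / dslope g b z)
    · exact hdh.analyticAt hn
    · have h1 : ∀ᶠ w in nhdsWithin z {z}ᶜ, w ≠ (a:ℂ) := by
        by_cases h : z = a
        · rw [h]; exact self_mem_nhdsWithin
        · exact mem_nhdsWithin_of_mem_nhds (isOpen_ne.mem_nhds h)
      have h2 : ∀ᶠ w in nhdsWithin z {z}ᶜ, w ≠ (b:ℂ) := by
        by_cases h : z = b
        · rw [h]; exact self_mem_nhdsWithin
        · exact mem_nhdsWithin_of_mem_nhds (isOpen_ne.mem_nhds h)
      filter_upwards [mem_nhdsWithin_of_mem_nhds hn, h1, h2] with w hw hw1 hw2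
      exact key w hw hw1 hw2

lemma core_pos (hr : 0 < r) (hab : a < b) (hd : DifferentiableOn ℂ g (Rect a b r))
    (hinj : InjOn g (Rect a b r))
    (hreal : ∀ z ∈ Rect a b r, g ((starRingEnd ℂ) z) = (starRingEnd ℂ) (g z))
    (hpos : ∀ z ∈ Rect a b r, 0 < z.im → 0 < (g z).im)
    (hneg : ∀ z ∈ Rect a b r, z.im < 0 → (g z).im < 0)
    {T : ℝ} (hT : 0 < T) (hT1 : T ≤ 1 / 10) (hT2 : T * (b - a) / 4 ≤ r / 100)
    {z : ℂ} (hz : |z.im| * (b - a) < T * ((z.re - a) * (b - z.re) - z.im ^ 2)) :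
    |(g z).im| * |(g b).re - (g a).re| <
      ((g z).re - (g a).re) * ((g b).re - (g z).re) - (g z).im ^ 2 := by
  have ha : a ∈ Ioo (a - r) (b + r) := ⟨by linarith, by linarith⟩
  have hb : b ∈ Ioo (a - r) (b + r) := ⟨by linarith, by linarith⟩
  have hm := g_mono hr hd hinj hreal hpos
  have hAB : (g a).re < (g b).re := hm ha hb hab
  have hba : 0 < b - a := by linarith
  set n1 := (z.re - a) * (b - z.re) - z.im ^ 2 with hn1
  have hn1p : 0 < n1 := by
    have : 0 ≤ |z.im| * (b - a) := by positivity
    exact (pos_iff_pos_of_mul_pos (this.trans_lt hz)).1 hT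
  have hprod : 0 < (z.re - a) * (b - z.re) := by nlinarith [sq_nonneg z.im]
  have hxa : a < z.re := by
    by_contra hc
    nlinarith
  have hxb : z.re < b := by
    by_contra hc
    nlinarith
  have hy : |z.im| ≤ T * (b - a) / 4 := by
    have h1 : n1 ≤ (b - a) ^ 2 / 4 := by nlinarith [sq_nonneg z.im, sq_nonneg (2 * z.re - a - b)]
    have h2 : |z.im| * (b - a) ≤ (T * (b - a) / 4) * (b - a) := by nlinarith
    exact le_of_mul_le_mul_right h2 hba
  have hxI : z.re ∈ Ioo (a - r) (b + r) := ⟨by linarith, by linarith⟩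
  have hball : ball (z.re : ℂ) r ⊆ Rect a b r := by
    intro w hw
    rw [mem_ball, dist_eq_norm] at hw
    have h1 := (Complex.abs_re_le_norm _).trans_lt hw
    have h2 := (Complex.abs_im_le_norm _).trans_lt hw
    simp only [Complex.sub_re, Complex.sub_im, Complex.ofReal_re, Complex.ofReal_im, sub_zero] at h1 h2
    rw [abs_lt] at h1 h2
    exact ⟨by linarith, by linarith, h2.1, h2.2⟩
  have hzx : ‖z - z.re‖ ≤ r / 100 := by
    have : z - z.re = z.im * Complex.I := by
      apply Complex.ext <;> simp
    rw [this]
    simp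
    linarith
  have hzR : z ∈ Rect a b r := hball (by rw [mem_ball, dist_eq_norm]; linarith)
  have hxR : (z.re : ℂ) ∈ Rect a b r := (mem_Rect_real hr).2 hxI
  set h : ℂ → ℂ := fun z => dslope g a z / dslope g b z with hh
  have hs : ∀ w ∈ Rect a b r, h w ∈ Complex.slitPlane := fun w hw =>
    h_slit hr hab hd hinj hreal hpos hneg hw
  have hdh : DifferentiableOn ℂ h (Rect a b r) := by
    apply DifferentiableOn.div
    · exact (Complex.differentiableOn_dslope ((Rect_open a b r).mem_nhds ((mem_Rect_real hr).2 ha))).2 hd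
    · exact (Complex.differentiableOn_dslope ((Rect_open a b r).mem_nhds ((mem_Rect_real hr).2 hb))).2 hd
    · exact fun z hz => Complex.slitPlane_ne_zero (phi_slit hr hd hinj hreal hpos hneg hb hz)
  have hga := g_real hr hreal ha
  have hgb := g_real hr hreal hb
  set A := (g a).re
  set B := (g b).re
  have hform : ∀ w : ℂ, w.re = z.re → h w = (g w - A) / (w - a) / ((g w - B) / (w - b)) := by
    intro w hw
    have h1 : w ≠ a := by
      rintro rfl
      simp at hw
      linarith
    have h2 : w ≠ b := by
      rintro rfl
      simp at hw
      linarith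
    rw [hh]
    simp only
    rw [dslope_of_ne _ h1, dslope_of_ne _ h2, slope_def_field, slope_def_field, hga, hgb]
  obtain ⟨p, hp⟩ : ∃ p : ℝ, h z.re = p := by
    rw [hform _ (by simp), g_real hr hreal hxI]
    exact ⟨((g z.re).re - A) / (z.re - a) / (((g z.re).re - B) / (z.re - b)), by push_cast; rfl⟩
  have hp0 : 0 < p := by
    have := hs _ hxR
    rw [hp] at this
    exact Complex.ofReal_mem_slitPlane.1 this
  have hE := schwarz_slit h z.re r p hr hp0 (hdh.mono hball) (fun w hw => hs w (hball hw)) hp z hzx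
  have hE1 := (Complex.abs_re_le_norm _).trans hE
  have hE2 := (Complex.abs_im_le_norm _).trans hE
  simp only [Complex.sub_re, Complex.sub_im, Complex.ofReal_re, Complex.ofReal_im, sub_zero] at hE1 hE2
  have hne := Complex.slitPlane_ne_zero (hs z hzR)
  have hf := hform z rfl
  rw [hf] at hne
  have hgzb : g z - B ≠ 0 := by
    intro h0
    rw [h0] at hne
    simp at hne
  have hza' : z - a ≠ 0 := by
    intro h0
    rw [h0] at hne
    simp at hne
  have hzb' : z - b ≠ 0 := by
    intro h0
    rw [h0] at hne
    simp at hne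
  have hM : 0 < Complex.normSq (g z - B) := Complex.normSq_pos.2 hgzb
  have hL : 0 < Complex.normSq (z - b) := Complex.normSq_pos.2 hzb'
  have e1 : (g z - A) * (z - b) = h z * ((z - a) * (g z - B)) := by
    rw [hf]
    field_simp
  have e2 : (g z - A) * (starRingEnd ℂ) (B - g z) * (Complex.normSq (z - b) : ℂ) =
      h z * ((z - a) * (starRingEnd ℂ) (b - z)) * (Complex.normSq (g z - B) : ℂ) := by
    rw [← Complex.mul_conj, ← Complex.mul_conj, ← neg_sub (g z) (B:ℂ), ← neg_sub z (b:ℂ), map_neg, map_neg]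
    linear_combination (-(starRingEnd ℂ) (g z - B) * (starRingEnd ℂ) (z - b)) * e1
  set M := Complex.normSq (g z - B)
  set L := Complex.normSq (z - b)
  have e3 := congrArg Complex.re e2
  have e4 := congrArg Complex.im e2
  rw [Complex.re_mul_ofReal, Complex.re_mul_ofReal] at e3
  rw [Complex.im_mul_ofReal, Complex.im_mul_ofReal] at e4
  simp only [Complex.mul_re, Complex.mul_im, Complex.sub_re, Complex.sub_im, Complex.ofReal_re, Complex.ofReal_im,
    Complex.conj_re, Complex.conj_im] at e3 e4
  set H1 := (h z).re
  set H2 := (h z).im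
  set n2 := z.im * (b - a) with hn2
  have hn2' : |n2| ≤ n1 / 10 := by
    rw [hn2, abs_mul, abs_of_pos hba]
    nlinarith
  have e5 : (((g z).re - A) * (B - (g z).re) - (g z).im ^ 2) * L = (H1 * n1 - H2 * n2) * M := by
    rw [hn1, hn2]; linear_combination e3
  have e6 : ((g z).im * (B - A)) * L = (H1 * n2 + H2 * n1) * M := by
    rw [hn1, hn2]; linear_combination e4
  have hb1 : |H2 * n2| ≤ p / 10 * (n1 / 10) := by
    rw [abs_mul]; gcongr
  have hb2 : |H2 * n1| ≤ p / 10 * n1 := by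
    rw [abs_mul, abs_of_pos hn1p]; gcongr
  have hH1 : |H1| ≤ 11 * p / 10 := by
    rw [abs_le] at *
    constructor <;> linarith
  have hb3 : |H1 * n2| ≤ 11 * p / 10 * (n1 / 10) := by
    rw [abs_mul]; gcongr
  have hb4 : 9 * p / 10 * n1 ≤ H1 * n1 := by
    rw [abs_le] at hE1
    gcongr
    linarith
  have hpn : 0 < p * n1 := by positivity
  have hfin : |H1 * n2 + H2 * n1| < H1 * n1 - H2 * n2 := by
    rw [abs_le] at hb1 hb2 hb3
    rw [abs_lt]
    constructor <;> linarith
  rw [← abs_mul]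
  refine lt_of_mul_lt_mul_right ?_ hL.le
  rw [e5]
  calc |(g z).im * (B - A)| * L = |((g z).im * (B - A)) * L| := by rw [abs_mul _ L, abs_of_pos hL]
    _ = |H1 * n2 + H2 * n1| * M := by rw [e6, abs_mul _ M, abs_of_pos hM]
    _ < _ := by gcongr

lemma core (hr : 0 < r) (hab : a < b) (hd : DifferentiableOn ℂ g (Rect a b r))
    (hinj : InjOn g (Rect a b r))
    (hreal : ∀ z ∈ Rect a b r, g ((starRingEnd ℂ) z) = (starRingEnd ℂ) (g z))
    {T : ℝ} (hT : 0 < T) (hT1 : T ≤ 1 / 10) (hT2 : T * (b - a) / 4 ≤ r / 100)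
    {z : ℂ} (hz : |z.im| * (b - a) < T * ((z.re - a) * (b - z.re) - z.im ^ 2)) :
    |(g z).im| * |(g b).re - (g a).re| <
      ((g z).re - (g a).re) * ((g b).re - (g z).re) - (g z).im ^ 2 := by
  have hconj : ∀ w ∈ Rect a b r, (starRingEnd ℂ) w ∈ Rect a b r := by
    rintro w ⟨h1, h2, h3, h4⟩
    exact ⟨by simpa using h1, by simpa using h2, by simp; linarith, by simp; linarith⟩
  have hne : ∀ w ∈ Rect a b r, 0 < w.im → (g w).im ≠ 0 := by
    intro w hw him h0
    have h1 : g ((starRingEnd ℂ) w) = g w := by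
      rw [hreal w hw, Complex.conj_eq_iff_im.2 h0]
    have h2 := hinj (hconj w hw) hw h1
    rw [Complex.conj_eq_iff_im] at h2
    linarith
  set U : Set ℂ := {w | w ∈ Rect a b r ∧ 0 < w.im} with hU
  have hUc : IsPreconnected U := by
    apply Convex.isPreconnected
    have : U = (Ioo (a - r) (b + r)) ×ℂ (Ioo 0 r) := by
      ext w
      simp only [hU, Rect, mem_setOf_eq, Complex.mem_reProdIm, mem_Ioo]
      constructor
      · rintro ⟨⟨h1, h2, h3, h4⟩, h5⟩
        exact ⟨⟨h1, h2⟩, h5, h4⟩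
      · rintro ⟨⟨h1, h2⟩, h5, h4⟩
        exact ⟨⟨h1, h2, by linarith, h4⟩, h5⟩
    rw [this]
    exact ((convex_Ioo (a - r) (b + r)).is_linear_preimage Complex.reLm.isLinear).inter
      ((convex_Ioo 0 r).is_linear_preimage Complex.imLm.isLinear)
  have hcont : ContinuousOn (fun w => (g w).im) U :=
    Complex.continuous_im.comp_continuousOn (hd.continuousOn.mono fun w hw => hw.1)
  have himg := hUc.image _ hcont
  have hsign : (∀ w ∈ U, 0 < (g w).im) ∨ (∀ w ∈ U, (g w).im < 0) := by
    by_contra hc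
    push Not at hc
    obtain ⟨⟨u, hu, hu1⟩, ⟨v, hv, hv1⟩⟩ := hc
    obtain ⟨w, hw, hw0⟩ := himg.ordConnected.out (mem_image_of_mem _ hu) (mem_image_of_mem _ hv) ⟨hu1, hv1⟩
    exact hne w hw.1 hw.2 hw0
  rcases hsign with hs | hs
  · refine core_pos hr hab hd hinj hreal (fun w hw h => hs w ⟨hw, h⟩) ?_ hT hT1 hT2 hz
    intro w hw h
    have := hs _ ⟨hconj w hw, by simpa using h⟩
    rw [hreal w hw] at this
    simpa using this
  · have := core_pos (g := fun w => - g w) hr hab hd.neg (fun x hx y hy hxy => hinj hx hy (neg_inj.1 hxy))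
      (fun w hw => by simp [hreal w hw]) (fun w hw h => by simpa using hs w ⟨hw, h⟩) (by
        intro w hw h
        have := hs _ ⟨hconj w hw, by simpa using h⟩
        rw [hreal w hw] at this
        simpa using this) hT hT1 hT2 hz
    simp only [Complex.neg_re, Complex.neg_im, abs_neg] at this
    rw [show -(g b).re - -(g a).re = -((g b).re - (g a).re) by ring, abs_neg] at this
    linarith
end core

lemma mem_Dtheta {a b θ : ℝ} (hab : a < b) (h0 : 0 < θ) (h1 : θ < Real.pi / 2) (z : ℂ) :
    z ∈ Dtheta a b θ ↔ z.im * (b - a) < Real.tan θ * ((z.re - a) * (b - z.re) - z.im ^ 2) := by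
  have hs : 0 < Real.sin θ := Real.sin_pos_of_pos_of_lt_pi h0 (by linarith)
  have hc : 0 < Real.cos θ := Real.cos_pos_of_mem_Ioo ⟨by linarith, by linarith⟩
  have hsc := Real.sin_sq_add_cos_sq θ
  have hba : 0 < b - a := by linarith
  rw [Dtheta, mem_ball, dist_eq_norm, ← sq_lt_sq₀ (norm_nonneg _) (by positivity),
    ← Complex.normSq_eq_norm_sq, Complex.normSq_apply, Real.tan_eq_sin_div_cos]
  simp only [Complex.sub_re, Complex.sub_im, Complex.mul_re, Complex.mul_im, Complex.ofReal_re,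
    Complex.ofReal_im, Complex.I_re, Complex.I_im]
  set s := Real.sin θ
  set c := Real.cos θ
  have hs2 : ((b - a) / (2 * s)) ^ 2 = ((b - a) / 2) ^ 2 + ((b - a) / 2 / (s / c)) ^ 2 := by
    field_simp
    linarith
  rw [hs2]
  have e : (b - a) / 2 / (s / c) = (b - a) * c / (2 * s) := by field_simp
  rw [e]
  have key : s / c * ((z.re - a) * (b - z.re) - z.im ^ 2) - z.im * (b - a) = s / c *
    ((((b - a) / 2) ^ 2 + ((b - a) * c / (2 * s)) ^ 2) - ((z.re - (a + b) / 2) * (z.re - (a + b) / 2) +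
      (z.im + (b - a) * c / (2 * s)) * (z.im + (b - a) * c / (2 * s)))) := by
    field_simp
    ring
  have hsc' : 0 < s / c := by positivity
  rw [← sub_pos, ← sub_pos (a := s / c * _), key, mul_pos_iff_of_pos_left hsc']
  ring_nf

lemma mem_Omega {a b θ : ℝ} (hab : a < b) (h0 : 0 < θ) (h1 : θ < Real.pi / 2) (z : ℂ) :
    z ∈ OmegaTheta a b θ ↔ |z.im| * (b - a) < Real.tan θ * ((z.re - a) * (b - z.re) - z.im ^ 2) := by
  have hT := Real.tan_pos_of_pos_of_lt_pi_div_two h0 h1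
  rw [OmegaTheta, mem_union, mem_union]
  have hc : z ∈ (fun z => (starRingEnd ℂ) z) '' DthetaUpper a b θ ↔
      (starRingEnd ℂ) z ∈ DthetaUpper a b θ := by
    constructor
    · rintro ⟨w, hw, rfl⟩
      simpa using hw
    · intro h
      exact ⟨_, h, by simp⟩
  rw [hc]
  simp only [DthetaUpper, mem_setOf_eq, mem_Dtheta hab h0 h1, Complex.conj_re, Complex.conj_im, neg_sq]
  rcases lt_trichotomy z.im 0 with h | h | h
  · rw [abs_of_neg h]
    constructor
    · rintro ((h1 | h1) | h1)
      · linarith [h1.2]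
      · exact h1.1
      · linarith [h1.1]
    · intro h1
      exact Or.inl (Or.inr ⟨h1, by linarith⟩)
  · rw [h]
    simp only [abs_zero, zero_mul, lt_irrefl, and_false, neg_zero, false_or, true_and]
    rw [mul_pos_iff_of_pos_left hT]
    constructor
    · rintro ⟨h2, h3⟩
      nlinarith
    · intro h2
      constructor <;> by_contra hc <;> nlinarith
  · rw [abs_of_pos h]
    constructor
    · rintro ((h1 | h1) | h1)
      · exact h1.1
      · linarith [h1.2]
      · linarith [h1.1]
    · intro h1
      exact Or.inl (Or.inl ⟨h1, h⟩)

/-- Lemma: let `I = (a, b) ⊂ ℝ` be a bounded open interval and `V` a simply connected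
domain, symmetric w.r.t. `ℝ`, with `closure I ⊂ V`. Then there are angles
`0 < θ* < θ*' < π/2` such that for every `θ ∈ (0, θ*)` there is `θ' ∈ (0, θ*')` with
`g (Ω_θ(I)) ⊆ Ω_{θ'}(g(I))` for every real univalent `g : V → ℂ` (both sides being
well-defined; here `g(I)` is the interval with endpoints `g a` and `g b`). -/
theorem stmt_11 (a b : ℝ) (hab : a < b) (V : Set ℂ)
    (hVopen : IsOpen V) (hVconn : IsConnected V) (hVsc : SimplyConnectedSpace V)
    (hVsym : ∀ z ∈ V, (starRingEnd ℂ) z ∈ V)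
    (hIV : {z : ℂ | z.im = 0 ∧ a ≤ z.re ∧ z.re ≤ b} ⊆ V) :
    ∃ θs θs' : ℝ, 0 < θs ∧ θs < θs' ∧ θs' < Real.pi / 2 ∧
      ∀ θ ∈ Set.Ioo 0 θs, ∃ θ' ∈ Set.Ioo 0 θs',
        OmegaTheta a b θ ⊆ V ∧
        ∀ g : ℂ → ℂ, DifferentiableOn ℂ g V → Set.InjOn g V →
          (∀ z ∈ V, g ((starRingEnd ℂ) z) = (starRingEnd ℂ) (g z)) →
          g '' OmegaTheta a b θ ⊆
            OmegaTheta (min (g a).re (g b).re) (max (g a).re (g b).re) θ' := by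
  set K : Set ℂ := {z : ℂ | z.im = 0 ∧ a ≤ z.re ∧ z.re ≤ b} with hK
  have hKc : IsCompact K := by
    have : K = (fun x : ℝ => (x : ℂ)) '' Icc a b := by
      ext z
      constructor
      · rintro ⟨h1, h2, h3⟩
        exact ⟨z.re, ⟨h2, h3⟩, by apply Complex.ext <;> simp [h1]⟩
      · rintro ⟨x, hx, rfl⟩
        exact ⟨by simp, by simpa using hx.1, by simpa using hx.2⟩
    rw [this]
    exact isCompact_Icc.image Complex.continuous_ofReal
  obtain ⟨δ, hδ, hδV⟩ := hKc.exists_thickening_subset_open hVopen hIV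
  set r := δ / 2 with hrdef
  have hr : 0 < r := by positivity
  have hRV : Rect a b r ⊆ V := by
    rintro z ⟨h1, h2, h3, h4⟩
    apply hδV
    rw [mem_thickening_iff]
    refine ⟨((max a (min z.re b) : ℝ) : ℂ), ⟨by simp, by simp, ?_⟩, ?_⟩
    · simp only [Complex.ofReal_re]
      exact max_le hab.le (min_le_right _ _)
    · rw [dist_eq_norm]
      refine (Complex.norm_le_abs_re_add_abs_im _).trans_lt ?_
      simp only [Complex.sub_re, Complex.sub_im, Complex.ofReal_re, Complex.ofReal_im, sub_zero]
      have e1 : |z.im| < r := abs_lt.2 ⟨h3, h4⟩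
      have e2 : |z.re - max a (min z.re b)| < r := by
        rw [abs_lt]
        rcases le_total z.re b with h | h
        · rw [min_eq_left h]
          rcases le_total a z.re with h' | h'
          · rw [max_eq_right h']; constructor <;> linarith
          · rw [max_eq_left h']; constructor <;> linarith
        · rw [min_eq_right h, max_eq_right hab.le]; constructor <;> linarith
      linarith
  have hba : 0 < b - a := by linarith
  have hpi := Real.pi_pos
  set η : ℝ := min (1 / 10) (r / (25 * (b - a))) with hη
  have hη0 : 0 < η := by
    rw [hη]
    exact lt_min (by norm_num) (by positivity)
  have hη1 : η ≤ 1 / 10 := min_le_left _ _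
  have hη2 : η * (b - a) / 4 ≤ r / 100 := by
    have : η ≤ r / (25 * (b - a)) := min_le_right _ _
    rw [le_div_iff₀ (by positivity)] at this
    linarith
  have hat : Real.arctan η < Real.pi / 4 := by
    rw [← Real.arctan_one]
    exact Real.arctan_strictMono (by linarith)
  refine ⟨Real.arctan η, Real.pi / 3, Real.arctan_pos.2 hη0, by linarith, by linarith, ?_⟩
  rintro θ ⟨hθ0, hθ1⟩
  have hθ2 : θ < Real.pi / 2 := by linarith
  have hT0 := Real.tan_pos_of_pos_of_lt_pi_div_two hθ0 hθ2
  have hTη : Real.tan θ < η := by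
    rw [← Real.tan_arctan η]
    exact Real.tan_lt_tan_of_lt_of_lt_pi_div_two (by linarith) (by linarith) hθ1
  have hT2 : Real.tan θ * (b - a) / 4 ≤ r / 100 := by nlinarith
  refine ⟨Real.pi / 4, ⟨by linarith, by linarith⟩, ?_, ?_⟩
  · intro z hz
    rw [mem_Omega hab hθ0 hθ2] at hz
    apply hRV
    set n1 := (z.re - a) * (b - z.re) - z.im ^ 2 with hn1
    have hn1p : 0 < n1 := by
      have : 0 ≤ |z.im| * (b - a) := by positivity
      exact (pos_iff_pos_of_mul_pos (this.trans_lt hz)).1 hT0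
    have hprod : 0 < (z.re - a) * (b - z.re) := by nlinarith [sq_nonneg z.im]
    have hxa : a < z.re := by
      by_contra hc
      nlinarith
    have hxb : z.re < b := by
      by_contra hc
      nlinarith
    have hy : |z.im| ≤ Real.tan θ * (b - a) / 4 := by
      have h1 : n1 ≤ (b - a) ^ 2 / 4 := by nlinarith [sq_nonneg z.im, sq_nonneg (2 * z.re - a - b)]
      have h2 : |z.im| * (b - a) ≤ (Real.tan θ * (b - a) / 4) * (b - a) := by nlinarith
      exact le_of_mul_le_mul_right h2 hba
    rw [abs_le] at hy
    exact ⟨by linarith, by linarith, by linarith, by linarith⟩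
  · rintro g hg hinj hreal _ ⟨z, hz, rfl⟩
    rw [mem_Omega hab hθ0 hθ2] at hz
    have hc := core hr hab (hg.mono hRV) (hinj.mono hRV) (fun w hw => hreal w (hRV hw)) hT0
      (by linarith) hT2 hz
    have hAB : (g a).re ≠ (g b).re := by
      intro h
      rw [h] at hc
      simp only [sub_self, abs_zero, mul_zero] at hc
      nlinarith [sq_nonneg ((g z).re - (g b).re), sq_nonneg (g z).im]
    rw [mem_Omega (by simpa using hAB.symm) (by linarith) (by linarith), Real.tan_pi_div_four, one_mul]
    rcases lt_or_gt_of_ne hAB with h | h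
    · rw [min_eq_left h.le, max_eq_right h.le]
      rwa [abs_of_pos (sub_pos.2 h)] at hc
    · rw [min_eq_right h.le, max_eq_left h.le]
      rw [abs_of_neg (sub_neg.2 h)] at hc
      linarith
end
end
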